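/- arXiv:2303.11896 — 9 statements merged into one kernel-verified Lean document; each statement's English description precedes it below -/
import Mathlib

section
/- Suppose 0 ≤ J(w) ≤ J_max for every w ∈ W, and suppose there exists at least one admissible crashing trajectory with budget J_max. Then the infimum, over all admissible crashing trajectories (t*, x, w) with budget J_max, of the peak cost sSup { J(w(t')) : t' ∈ [0, t*] } is equal to the infimum of the set { z ∈ [0, J_max] : there exists an admissible crashing trajectory with budget z }. (Equivalence of the peak-minimizing optimal control problem with its Mayer reformulation obtained by adjoining the constant state z.) -/
open Set MeasureTheory

/-- An admissible crashing trajectory with budget `z`: a stopping time `tStar ∈ [0, T]`,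
a measurable input `w` staying in `W` with cost at most `z` on `[0, tStar]`, and a state
trajectory `x` staying in `X`, starting in `X₀`, following the dynamics `f`, and ending
in the unsafe set `Xu` at time `tStar`. -/
def IsCrashingTraj {n L : ℕ} (X X₀ Xu : Set (Fin n → ℝ)) (W : Set (Fin L → ℝ))
    (T : ℝ) (J : (Fin L → ℝ) → ℝ)
    (f : ℝ → (Fin n → ℝ) → (Fin L → ℝ) → (Fin n → ℝ))
    (z : ℝ) (tStar : ℝ) (x : ℝ → Fin n → ℝ) (w : ℝ → Fin L → ℝ) : Prop :=
  tStar ∈ Icc (0 : ℝ) T ∧ Measurable w ∧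
  (∀ t' ∈ Icc (0 : ℝ) tStar, w t' ∈ W ∧ J (w t') ≤ z) ∧
  (∀ t' ∈ Icc (0 : ℝ) tStar, x t' ∈ X) ∧ x 0 ∈ X₀ ∧
  (∀ t' ∈ Icc (0 : ℝ) tStar, HasDerivAt x (f t' (x t') (w t')) t') ∧
  x tStar ∈ Xu

/-- Equivalence of the peak-minimizing OCP with its Mayer reformulation: under
`0 ≤ J ≤ J_max` on `W` and feasibility at budget `J_max`, the infimum over crashing
trajectories of the peak cost `sSup {J(w(t')) : t' ∈ [0, tStar]}` equals the infimum of
budgets `z ∈ [0, J_max]` admitting a crashing trajectory. -/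
theorem crash_peak_eq_mayer {n L : ℕ} (X X₀ Xu : Set (Fin n → ℝ)) (W : Set (Fin L → ℝ))
    (T Jmax : ℝ) (hT : 0 < T) (hJmax : 0 < Jmax)
    (hX₀ : X₀ ⊆ X) (hXu : Xu ⊆ X)
    (J : (Fin L → ℝ) → ℝ)
    (f : ℝ → (Fin n → ℝ) → (Fin L → ℝ) → (Fin n → ℝ))
    (hJ : ∀ w ∈ W, 0 ≤ J w ∧ J w ≤ Jmax)
    (hfeas : ∃ tStar x w, IsCrashingTraj X X₀ Xu W T J f Jmax tStar x w) :
    sInf { c : ℝ | ∃ tStar x w, IsCrashingTraj X X₀ Xu W T J f Jmax tStar x w ∧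
        c = sSup ((fun t' => J (w t')) '' Icc (0 : ℝ) tStar) } =
    sInf { z : ℝ | z ∈ Icc (0 : ℝ) Jmax ∧
        ∃ tStar x w, IsCrashingTraj X X₀ Xu W T J f z tStar x w } := by
  have peak_le {z tStar : ℝ} {x : ℝ → Fin n → ℝ} {w : ℝ → Fin L → ℝ}
      (h : IsCrashingTraj X X₀ Xu W T J f z tStar x w) :
      sSup ((fun t' => J (w t')) '' Icc (0 : ℝ) tStar) ≤ z := by
    obtain ⟨ht, -, hw, -⟩ := h
    refine csSup_le ((nonempty_Icc.2 ht.1).image _) ?_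
    rintro _ ⟨t, h', rfl⟩
    exact (hw t h').2
  have peak_nonneg {tStar : ℝ} {x : ℝ → Fin n → ℝ} {w : ℝ → Fin L → ℝ}
      (h : IsCrashingTraj X X₀ Xu W T J f Jmax tStar x w) :
      0 ≤ sSup ((fun t' => J (w t')) '' Icc (0 : ℝ) tStar) := by
    refine Real.sSup_nonneg ?_
    rintro _ ⟨t, h', rfl⟩
    exact (hJ _ (h.2.2.1 t h').1).1
  obtain ⟨t₀, x₀, w₀, h₀⟩ := hfeas
  apply le_antisymm
  · refine le_csInf ⟨Jmax, ⟨hJmax.le, le_rfl⟩, t₀, x₀, w₀, h₀⟩ ?_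
    rintro z ⟨hz, t, x, w, h⟩
    have hmax : IsCrashingTraj X X₀ Xu W T J f Jmax t x w := by
      obtain ⟨ht, hm, hw, hx⟩ := h
      exact ⟨ht, hm, fun s hs => ⟨(hw s hs).1, (hw s hs).2.trans hz.2⟩, hx⟩
    refine le_trans (csInf_le ⟨0, ?_⟩ ⟨t, x, w, hmax, rfl⟩) (peak_le h)
    rintro _ ⟨t, x, w, h, rfl⟩
    exact peak_nonneg h
  · refine le_csInf ⟨_, t₀, x₀, w₀, h₀, rfl⟩ ?_
    rintro _ ⟨t, x, w, h, rfl⟩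
    refine csInf_le ⟨0, fun z hz => hz.1.1⟩ ⟨⟨peak_nonneg h, peak_le h⟩, t, x, w, ?_⟩
    obtain ⟨ht, hm, hw, hx⟩ := h
    refine ⟨ht, hm, fun s hs => ⟨(hw s hs).1, ?_⟩, hx⟩
    refine le_csSup ⟨Jmax, ?_⟩ (mem_image_of_mem (fun t' => J (w t')) hs)
    rintro _ ⟨r, hr, rfl⟩
    exact (hw r hr).2
end

section
/- Let v : ℝ × ℝⁿ × ℝ → ℝ be continuously differentiable and γ ∈ ℝ satisfy: (i) v(0, x, z) ≥ γ for all (x, z) ∈ X₀ × [0, J_max]; (ii) v(t, x, z) ≤ z for all (t, x, z) ∈ [0, T] × X_u × [0, J_max]; (iii) L_f v(t, x, z, w) ≥ 0 for all t ∈ [0, T], x ∈ X, and (w, z) ∈ Ω. Then for every z ∈ [0, J_max] for which there exists an admissible crashing trajectory with budget z, one has γ ≤ z. In particular γ is a lower bound on the minimal crash budget. -/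
open Set MeasureTheory

/-- The Lie derivative `L_f v(t, x, z, w) = ∂_t v + f(t, x, w) ⋅ ∇_x v`, expressed as the
total derivative of `v` in the direction `(1, f(t, x, w), 0)`. -/
noncomputable def lieDeriv {n L : ℕ}
    (f : ℝ → (Fin n → ℝ) → (Fin L → ℝ) → (Fin n → ℝ))
    (v : ℝ × (Fin n → ℝ) × ℝ → ℝ)
    (t : ℝ) (x : Fin n → ℝ) (z : ℝ) (w : Fin L → ℝ) : ℝ :=
  fderiv ℝ v (t, x, z) (1, f t x w, 0)

/-- Any feasible pair `(γ, v)` of the crash-safety LP lower-bounds every feasible crash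
budget: if `v(0,·,·) ≥ γ` on `X₀ × [0, J_max]`, `v ≤ z` on `[0, T] × X_u × [0, J_max]`,
and `L_f v ≥ 0` on `[0, T] × X × Ω`, then `γ ≤ z` whenever budget `z` admits a crashing
trajectory. -/
theorem crash_lp_lower_bound {n L : ℕ} (X X₀ Xu : Set (Fin n → ℝ)) (W : Set (Fin L → ℝ))
    (T Jmax : ℝ) (hT : 0 < T) (hJmax : 0 < Jmax)
    (hX₀ : X₀ ⊆ X) (hXu : Xu ⊆ X)
    (J : (Fin L → ℝ) → ℝ)
    (f : ℝ → (Fin n → ℝ) → (Fin L → ℝ) → (Fin n → ℝ))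
    (v : ℝ × (Fin n → ℝ) × ℝ → ℝ) (hv : ContDiff ℝ 1 v) (γ : ℝ)
    (h0 : ∀ x ∈ X₀, ∀ z ∈ Icc (0 : ℝ) Jmax, γ ≤ v (0, x, z))
    (hu : ∀ t ∈ Icc (0 : ℝ) T, ∀ x ∈ Xu, ∀ z ∈ Icc (0 : ℝ) Jmax, v (t, x, z) ≤ z)
    (hlie : ∀ t ∈ Icc (0 : ℝ) T, ∀ x ∈ X, ∀ w ∈ W, ∀ z ∈ Icc (0 : ℝ) Jmax,
      J w ≤ z → 0 ≤ lieDeriv f v t x z w) :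
    ∀ z ∈ Icc (0 : ℝ) Jmax,
      (∃ tStar x w, IsCrashingTraj X X₀ Xu W T J f z tStar x w) → γ ≤ z := by
  rintro z hz ⟨tStar, x, w, ⟨ht0, htT⟩, -, hw, hx, hx0, hx', hxu⟩
  have hderiv : ∀ t ∈ Icc (0 : ℝ) tStar,
      HasDerivAt (fun s => v (s, x s, z)) (lieDeriv f v t (x t) z (w t)) t := fun t ht =>
    (hv.differentiable one_ne_zero (t, x t, z)).hasFDerivAt.comp_hasDerivAt t
      ((hasDerivAt_id t).prodMk ((hx' t ht).prodMk (hasDerivAt_const t z)))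
  have hmono : MonotoneOn (fun s => v (s, x s, z)) (Icc 0 tStar) := by
    refine monotoneOn_of_deriv_nonneg (convex_Icc 0 tStar)
      (fun t ht => (hderiv t ht).continuousAt.continuousWithinAt)
      (fun t ht => (hderiv t (interior_subset ht)).differentiableAt.differentiableWithinAt)
      fun t ht => ?_
    have ht' := interior_subset ht
    rw [(hderiv t ht').deriv]
    exact hlie t ⟨ht'.1, ht'.2.trans htT⟩ (x t) (hx t ht') (w t) (hw t ht').1 z hz (hw t ht').2
  calc γ ≤ v (0, x 0, z) := h0 (x 0) hx0 z hz
    _ ≤ v (tStar, x tStar, z) := hmono (left_mem_Icc.2 ht0) (right_mem_Icc.2 ht0) ht0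
    _ ≤ z := hu tStar ⟨ht0, htT⟩ (x tStar) hxu z hz
end

section
/- Assume f is continuous, W is compact, and let (t*, x, w) be an admissible crashing trajectory with budget z ∈ [0, J_max] in which x is continuous and w is measurable. Define μ₀ = δ_{(x(0), z)} (a Dirac measure on ℝⁿ × ℝ), μ_u = δ_{(t*, x(t*), z)} (a Dirac measure on ℝ × ℝⁿ × ℝ), and μ = the pushforward under t ↦ (t, x(t), z, w(t)) of Lebesgue measure restricted to [0, t*] (a measure on ℝ × ℝⁿ × ℝ × ℝ^L). Then: μ₀ and μ_u are probability measures vanishing outside X₀ × [0, J_max] and [0, T] × X_u × [0, J_max] respectively; μ has total mass t* and vanishes outside { (t, x, z, w) : t ∈ [0, T], x ∈ X, (w, z) ∈ Ω }; the objective satisfies ∫ z̃ dμ_u(t̃, x̃, z̃) = z; and for every continuously differentiable v : ℝ × ℝⁿ × ℝ → ℝ the Liouville equation holds: ∫ v(t̃, x̃, z̃) dμ_u = ∫ v(0, x̃, z̃) dμ₀ + ∫ L_f v(t̃, x̃, z̃, w̃) dμ. (Existence of a feasible solution to the measure linear program from a crashing trajectory.) -/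
open Set MeasureTheory

/-- The pushforward of a measure under `t ↦ (t, g t)`, with `g` measurable, vanishes outside any set
(not necessarily measurable) that contains the part of the graph of `g` above the support set. -/
theorem map_graph_restrict_compl_eq_zero {α β : Type*} [MeasurableSpace α] [MeasurableSpace β]
    [MeasurableEq β] {μ : Measure α} {g : α → β} (hg : Measurable g)
    {A : Set α} (hA : MeasurableSet A) {S : Set (α × β)} (hS : ∀ t ∈ A, (t, g t) ∈ S) :
    Measure.map (fun t => (t, g t)) (μ.restrict A) Sᶜ = 0 := by
  have hG : MeasurableSet {p : α × β | p.1 ∈ A ∧ p.2 = g p.1} :=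
    (measurable_fst hA).inter (measurableSet_eq_fun measurable_snd (hg.comp measurable_fst))
  refine measure_mono_null (t := {p : α × β | p.1 ∈ A ∧ p.2 = g p.1}ᶜ) ?_ ?_
  · refine compl_subset_compl.2 ?_
    rintro ⟨t, y⟩ ⟨ht, hy⟩
    obtain rfl : y = g t := hy
    exact hS t ht
  · have hγ : Measurable fun t => (t, g t) := measurable_id.prodMk hg
    rw [Measure.map_apply hγ hG.compl, Measure.restrict_apply (hγ hG.compl)]
    convert measure_empty (μ := μ)
    ext t
    simp

theorem continuous_lieDeriv {n L : ℕ}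
    {f : ℝ → (Fin n → ℝ) → (Fin L → ℝ) → (Fin n → ℝ)}
    (hf : Continuous fun p : ℝ × (Fin n → ℝ) × (Fin L → ℝ) => f p.1 p.2.1 p.2.2)
    {v : ℝ × (Fin n → ℝ) × ℝ → ℝ} (hv : ContDiff ℝ 1 v) :
    Continuous fun p : ℝ × (Fin n → ℝ) × ℝ × (Fin L → ℝ) =>
      lieDeriv f v p.1 p.2.1 p.2.2.1 p.2.2.2 := by
  have hf' : Continuous fun p : ℝ × (Fin n → ℝ) × ℝ × (Fin L → ℝ) => f p.1 p.2.1 p.2.2.2 :=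
    hf.comp (f := fun p : ℝ × (Fin n → ℝ) × ℝ × (Fin L → ℝ) => (p.1, p.2.1, p.2.2.2))
      (by fun_prop)
  have hv' := hv.continuous_fderiv one_ne_zero
  unfold lieDeriv
  exact (hv'.comp (by fun_prop)).clm_apply (by fun_prop)

/-- A continuous function composed with a measurable curve that stays in a compact set is
integrable on a set of finite measure. -/
theorem integrableOn_comp_of_mapsTo_isCompact {α β : Type*} [MeasurableSpace α]
    [TopologicalSpace β] [MeasurableSpace β] [BorelSpace β]
    {μ : Measure α} {A : Set α} (hA : MeasurableSet A) (hμ : μ A ≠ ⊤)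
    {F : β → ℝ} (hF : Continuous F) {g : α → β} (hg : Measurable g)
    {K : Set β} (hK : IsCompact K) (hgK : MapsTo g A K) :
    IntegrableOn (fun t => F (g t)) A μ := by
  obtain ⟨C, hC⟩ := hK.exists_bound_of_continuousOn hF.continuousOn
  exact Measure.integrableOn_of_bounded hμ (hF.measurable.comp hg).aestronglyMeasurable
    ((ae_restrict_iff' hA).2 (.of_forall fun t ht => hC _ (hgK ht)))

theorem hasDerivAt_comp_traj {n L : ℕ}
    {f : ℝ → (Fin n → ℝ) → (Fin L → ℝ) → (Fin n → ℝ)}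
    {v : ℝ × (Fin n → ℝ) × ℝ → ℝ} (hv : Differentiable ℝ v) (z : ℝ)
    {x : ℝ → Fin n → ℝ} {w : ℝ → Fin L → ℝ} {t : ℝ}
    (hx : HasDerivAt x (f t (x t) (w t)) t) :
    HasDerivAt (fun s => v (s, x s, z)) (lieDeriv f v t (x t) z (w t)) t :=
  (hv (t, x t, z)).hasFDerivAt.comp_hasDerivAt t
    ((hasDerivAt_id t).prodMk (hx.prodMk (hasDerivAt_const t z)))

/-- From a crashing trajectory one obtains a feasible solution `(μ₀, μ_u, μ)` of the
measure LP: Dirac initial/terminal measures and the occupation measure of the trajectory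
satisfy the support, mass, objective, and Liouville constraints. -/
theorem crash_measure_feasible {n L : ℕ} (X X₀ Xu : Set (Fin n → ℝ)) (W : Set (Fin L → ℝ))
    (T Jmax : ℝ) (hT : 0 < T) (hJmax : 0 < Jmax)
    (hX₀ : X₀ ⊆ X) (hXu : Xu ⊆ X)
    (J : (Fin L → ℝ) → ℝ)
    (f : ℝ → (Fin n → ℝ) → (Fin L → ℝ) → (Fin n → ℝ))
    (hf : Continuous fun p : ℝ × (Fin n → ℝ) × (Fin L → ℝ) => f p.1 p.2.1 p.2.2)
    (hW : IsCompact W)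
    (z : ℝ) (hz : z ∈ Icc (0 : ℝ) Jmax)
    (tStar : ℝ) (x : ℝ → Fin n → ℝ) (w : ℝ → Fin L → ℝ)
    (hx : Continuous x)
    (htraj : IsCrashingTraj X X₀ Xu W T J f z tStar x w) :
    (IsProbabilityMeasure (Measure.dirac ((x 0, z) : (Fin n → ℝ) × ℝ)) ∧
      Measure.dirac ((x 0, z) : (Fin n → ℝ) × ℝ) (X₀ ×ˢ Icc (0 : ℝ) Jmax)ᶜ = 0) ∧
    (IsProbabilityMeasure
        (Measure.dirac ((tStar, x tStar, z) : ℝ × (Fin n → ℝ) × ℝ)) ∧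
      Measure.dirac ((tStar, x tStar, z) : ℝ × (Fin n → ℝ) × ℝ)
        (Icc (0 : ℝ) T ×ˢ (Xu ×ˢ Icc (0 : ℝ) Jmax))ᶜ = 0) ∧
    (Measure.map (fun t => ((t, x t, z, w t) : ℝ × (Fin n → ℝ) × ℝ × (Fin L → ℝ)))
        (volume.restrict (Icc (0 : ℝ) tStar)) Set.univ = ENNReal.ofReal tStar ∧
      Measure.map (fun t => ((t, x t, z, w t) : ℝ × (Fin n → ℝ) × ℝ × (Fin L → ℝ)))
        (volume.restrict (Icc (0 : ℝ) tStar))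
        { p : ℝ × (Fin n → ℝ) × ℝ × (Fin L → ℝ) |
          p.1 ∈ Icc (0 : ℝ) T ∧ p.2.1 ∈ X ∧ p.2.2.2 ∈ W ∧
          p.2.2.1 ∈ Icc (0 : ℝ) Jmax ∧ J p.2.2.2 ≤ p.2.2.1 }ᶜ = 0) ∧
    (∫ p : ℝ × (Fin n → ℝ) × ℝ, p.2.2
        ∂(Measure.dirac ((tStar, x tStar, z) : ℝ × (Fin n → ℝ) × ℝ)) = z) ∧
    (∀ v : ℝ × (Fin n → ℝ) × ℝ → ℝ, ContDiff ℝ 1 v →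
      ∫ p, v p ∂(Measure.dirac ((tStar, x tStar, z) : ℝ × (Fin n → ℝ) × ℝ)) =
        (∫ p : (Fin n → ℝ) × ℝ, v (0, p.1, p.2)
            ∂(Measure.dirac ((x 0, z) : (Fin n → ℝ) × ℝ))) +
        ∫ p : ℝ × (Fin n → ℝ) × ℝ × (Fin L → ℝ),
            lieDeriv f v p.1 p.2.1 p.2.2.1 p.2.2.2
          ∂(Measure.map
              (fun t => ((t, x t, z, w t) : ℝ × (Fin n → ℝ) × ℝ × (Fin L → ℝ)))
              (volume.restrict (Icc (0 : ℝ) tStar)))) := by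
  obtain ⟨ht, hw, hwW, hxX, hx0, hxd, hxu⟩ := htraj
  have hg : Measurable fun t => ((x t, z, w t) : (Fin n → ℝ) × ℝ × (Fin L → ℝ)) :=
    hx.measurable.prodMk (measurable_const.prodMk hw)
  have hγ : Measurable fun t => ((t, x t, z, w t) : ℝ × (Fin n → ℝ) × ℝ × (Fin L → ℝ)) :=
    measurable_id.prodMk hg
  refine ⟨⟨inferInstance, ?_⟩, ⟨inferInstance, ?_⟩, ⟨?_, ?_⟩, ?_, fun v hv => ?_⟩
  · rw [Measure.dirac_apply]
    exact indicator_of_notMem (not_not.2 ⟨hx0, hz⟩) _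
  · rw [Measure.dirac_apply]
    exact indicator_of_notMem (not_not.2 ⟨ht, hxu, hz⟩) _
  · rw [Measure.map_apply hγ .univ]
    simp
  · exact map_graph_restrict_compl_eq_zero hg measurableSet_Icc fun t htm =>
      ⟨⟨htm.1, htm.2.trans ht.2⟩, hxX t htm, (hwW t htm).1, hz, (hwW t htm).2⟩
  · rw [integral_dirac]
  · have hLie := continuous_lieDeriv hf hv
    have hK : IsCompact (Icc (0 : ℝ) tStar ×ˢ ((x '' Icc 0 tStar) ×ˢ (({z} : Set ℝ) ×ˢ W))) :=
      isCompact_Icc.prod ((isCompact_Icc.image hx).prod (isCompact_singleton.prod hW))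
    have hint : IntegrableOn (fun t => lieDeriv f v t (x t) z (w t)) (Icc 0 tStar) volume :=
      integrableOn_comp_of_mapsTo_isCompact measurableSet_Icc measure_Icc_lt_top.ne hLie hγ hK
        fun t htm => ⟨htm, mem_image_of_mem x htm, rfl, (hwW t htm).1⟩
    rw [integral_dirac, integral_dirac, integral_map hγ.aemeasurable hLie.aestronglyMeasurable,
      integral_Icc_eq_integral_Ioc, ← intervalIntegral.integral_of_le ht.1,
      intervalIntegral.integral_eq_sub_of_hasDerivAt (f := fun s => v (s, x s, z))
        (fun t htm => hasDerivAt_comp_traj (hv.differentiable one_ne_zero) z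
          (hxd t (uIcc_of_le ht.1 ▸ htm)))
        ((intervalIntegrable_iff_integrableOn_Icc_of_le ht.1).2 hint)]
    ring
end

section
/- Weak duality between the function and measure linear programs: let μ₀ be a Borel probability measure on ℝⁿ × ℝ vanishing outside X₀ × [0, J_max], μ_u a finite Borel measure on ℝ × ℝⁿ × ℝ vanishing outside [0, T] × X_u × [0, J_max], and μ a finite Borel measure on ℝ × ℝⁿ × ℝ × ℝ^L vanishing outside { (t, x, z, w) : t ∈ [0, T], x ∈ X, (w, z) ∈ Ω }. Let v : ℝ × ℝⁿ × ℝ → ℝ be continuously differentiable and γ ∈ ℝ satisfy v(0, x, z) ≥ γ on X₀ × [0, J_max], v(t, x, z) ≤ z on [0, T] × X_u × [0, J_max], and L_f v(t, x, z, w) ≥ 0 for all t ∈ [0, T], x ∈ X, (w, z) ∈ Ω. If v, v(0, ·, ·), L_f v, and (t, x, z) ↦ z are integrable with respect to the relevant measures and the Liouville equation ∫ v dμ_u = ∫ v(0, x̃, z̃) dμ₀ + ∫ L_f v dμ holds, then γ ≤ ∫ z̃ dμ_u(t̃, x̃, z̃). -/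
open Set MeasureTheory

/-- Weak duality between the function LP and the measure LP: any feasible `(γ, v)` of the
function program and any feasible `(μ₀, μ_u, μ)` of the measure program satisfying the
Liouville equation obey `γ ≤ ∫ z̃ dμ_u`. -/
theorem crash_weak_duality {n L : ℕ} (X X₀ Xu : Set (Fin n → ℝ)) (W : Set (Fin L → ℝ))
    (T Jmax : ℝ) (hT : 0 < T) (hJmax : 0 < Jmax)
    (hX₀ : X₀ ⊆ X) (hXu : Xu ⊆ X)
    (J : (Fin L → ℝ) → ℝ)
    (f : ℝ → (Fin n → ℝ) → (Fin L → ℝ) → (Fin n → ℝ))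
    (μ₀ : Measure ((Fin n → ℝ) × ℝ)) [IsProbabilityMeasure μ₀]
    (μu : Measure (ℝ × (Fin n → ℝ) × ℝ)) [IsFiniteMeasure μu]
    (μ : Measure (ℝ × (Fin n → ℝ) × ℝ × (Fin L → ℝ))) [IsFiniteMeasure μ]
    (hμ₀supp : μ₀ (X₀ ×ˢ Icc (0 : ℝ) Jmax)ᶜ = 0)
    (hμusupp : μu (Icc (0 : ℝ) T ×ˢ (Xu ×ˢ Icc (0 : ℝ) Jmax))ᶜ = 0)
    (hμsupp : μ { p : ℝ × (Fin n → ℝ) × ℝ × (Fin L → ℝ) |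
        p.1 ∈ Icc (0 : ℝ) T ∧ p.2.1 ∈ X ∧ p.2.2.2 ∈ W ∧
        p.2.2.1 ∈ Icc (0 : ℝ) Jmax ∧ J p.2.2.2 ≤ p.2.2.1 }ᶜ = 0)
    (v : ℝ × (Fin n → ℝ) × ℝ → ℝ) (hv : ContDiff ℝ 1 v) (γ : ℝ)
    (h0 : ∀ x ∈ X₀, ∀ z ∈ Icc (0 : ℝ) Jmax, γ ≤ v (0, x, z))
    (hu : ∀ t ∈ Icc (0 : ℝ) T, ∀ x ∈ Xu, ∀ z ∈ Icc (0 : ℝ) Jmax, v (t, x, z) ≤ z)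
    (hlie : ∀ t ∈ Icc (0 : ℝ) T, ∀ x ∈ X, ∀ w ∈ W, ∀ z ∈ Icc (0 : ℝ) Jmax,
      J w ≤ z → 0 ≤ lieDeriv f v t x z w)
    (hint_u : Integrable (fun p : ℝ × (Fin n → ℝ) × ℝ => v p) μu)
    (hint_0 : Integrable (fun p : (Fin n → ℝ) × ℝ => v (0, p.1, p.2)) μ₀)
    (hint_lie : Integrable
      (fun p : ℝ × (Fin n → ℝ) × ℝ × (Fin L → ℝ) =>
        lieDeriv f v p.1 p.2.1 p.2.2.1 p.2.2.2) μ)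
    (hint_z : Integrable (fun p : ℝ × (Fin n → ℝ) × ℝ => p.2.2) μu)
    (hLiouville : ∫ p, v p ∂μu =
      (∫ p : (Fin n → ℝ) × ℝ, v (0, p.1, p.2) ∂μ₀) +
      ∫ p : ℝ × (Fin n → ℝ) × ℝ × (Fin L → ℝ),
        lieDeriv f v p.1 p.2.1 p.2.2.1 p.2.2.2 ∂μ) :
    γ ≤ ∫ p : ℝ × (Fin n → ℝ) × ℝ, p.2.2 ∂μu := by
  have ae_u : ∀ᵐ p ∂μu, p ∈ Icc (0 : ℝ) T ×ˢ (Xu ×ˢ Icc (0 : ℝ) Jmax) := hμusupp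
  have ae_0 : ∀ᵐ p ∂μ₀, p ∈ X₀ ×ˢ Icc (0 : ℝ) Jmax := hμ₀supp
  have le_z : ∫ p, v p ∂μu ≤ ∫ p : ℝ × (Fin n → ℝ) × ℝ, p.2.2 ∂μu := by
    refine integral_mono_ae hint_u hint_z ?_
    filter_upwards [ae_u] with p hp
    exact hu p.1 hp.1 p.2.1 hp.2.1 p.2.2 hp.2.2
  have le_init : γ ≤ ∫ p : (Fin n → ℝ) × ℝ, v (0, p.1, p.2) ∂μ₀ := by
    have hγ : ∫ _ : (Fin n → ℝ) × ℝ, γ ∂μ₀ ≤ ∫ p : (Fin n → ℝ) × ℝ, v (0, p.1, p.2) ∂μ₀ := by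
      refine integral_mono_ae (integrable_const γ) hint_0 ?_
      filter_upwards [ae_0] with p hp
      exact h0 p.1 hp.1 p.2 hp.2
    simpa using hγ
  have lie_nonneg : 0 ≤ ∫ p : ℝ × (Fin n → ℝ) × ℝ × (Fin L → ℝ),
      lieDeriv f v p.1 p.2.1 p.2.2.1 p.2.2.2 ∂μ := by
    refine integral_nonneg_of_ae ?_
    filter_upwards [mem_ae_iff.mpr hμsupp] with p hp
    obtain ⟨ht, hx, hw, hz, hJ⟩ := hp
    exact hlie p.1 ht p.2.1 hx p.2.2.2 hw p.2.2.1 hz hJ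
  linarith
end

section
/- Boundedness of feasible measures: let μ₀ be a Borel probability measure on ℝⁿ × ℝ, μ_u a finite Borel measure on ℝ × ℝⁿ × ℝ vanishing outside [0, T] × X_u × [0, J_max], and μ a finite Borel measure on ℝ × ℝⁿ × ℝ × ℝ^L. Suppose the Liouville equation ∫ v(t̃, x̃, z̃) dμ_u = ∫ v(0, x̃, z̃) dμ₀ + ∫ L_f v(t̃, x̃, z̃, w̃) dμ holds both for the constant function v ≡ 1 and for the function v(t, x, z) = t. Then μ_u is a probability measure, the total mass of μ equals ∫ t̃ dμ_u(t̃, x̃, z̃), and this mass is at most T. -/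
open Set MeasureTheory

theorem lieDeriv_const {n L : ℕ} (f : ℝ → (Fin n → ℝ) → (Fin L → ℝ) → (Fin n → ℝ)) (c t : ℝ)
    (x : Fin n → ℝ) (z : ℝ) (w : Fin L → ℝ) : lieDeriv f (fun _ => c) t x z w = 0 := by
  simp [lieDeriv]

theorem lieDeriv_time {n L : ℕ} (f : ℝ → (Fin n → ℝ) → (Fin L → ℝ) → (Fin n → ℝ)) (t : ℝ)
    (x : Fin n → ℝ) (z : ℝ) (w : Fin L → ℝ) : lieDeriv f (fun q => q.1) t x z w = 1 := by
  simp [lieDeriv, fderiv_fst]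

/-- Boundedness of feasible measures: if the Liouville equation holds for the test
functions `v ≡ 1` and `v(t, x, z) = t`, then `μ_u` is a probability measure, the total
mass of `μ` equals `∫ t̃ dμ_u`, and this mass is at most `T`. -/
theorem crash_measures_bounded {n L : ℕ} (X Xu : Set (Fin n → ℝ))
    (T Jmax : ℝ) (hT : 0 < T) (hJmax : 0 < Jmax) (hXu : Xu ⊆ X)
    (f : ℝ → (Fin n → ℝ) → (Fin L → ℝ) → (Fin n → ℝ))
    (μ₀ : Measure ((Fin n → ℝ) × ℝ)) [IsProbabilityMeasure μ₀]
    (μu : Measure (ℝ × (Fin n → ℝ) × ℝ)) [IsFiniteMeasure μu]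
    (μ : Measure (ℝ × (Fin n → ℝ) × ℝ × (Fin L → ℝ))) [IsFiniteMeasure μ]
    (hμusupp : μu (Icc (0 : ℝ) T ×ˢ (Xu ×ˢ Icc (0 : ℝ) Jmax))ᶜ = 0)
    (hLiou_one : ∫ p : ℝ × (Fin n → ℝ) × ℝ,
        (fun _ : ℝ × (Fin n → ℝ) × ℝ => (1 : ℝ)) p ∂μu =
      (∫ p : (Fin n → ℝ) × ℝ,
          (fun _ : ℝ × (Fin n → ℝ) × ℝ => (1 : ℝ)) (0, p.1, p.2) ∂μ₀) +
      ∫ p : ℝ × (Fin n → ℝ) × ℝ × (Fin L → ℝ),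
        lieDeriv f (fun _ => (1 : ℝ)) p.1 p.2.1 p.2.2.1 p.2.2.2 ∂μ)
    (hLiou_t : ∫ p : ℝ × (Fin n → ℝ) × ℝ,
        (fun q : ℝ × (Fin n → ℝ) × ℝ => q.1) p ∂μu =
      (∫ p : (Fin n → ℝ) × ℝ,
          (fun q : ℝ × (Fin n → ℝ) × ℝ => q.1) (0, p.1, p.2) ∂μ₀) +
      ∫ p : ℝ × (Fin n → ℝ) × ℝ × (Fin L → ℝ),
        lieDeriv f (fun q => q.1) p.1 p.2.1 p.2.2.1 p.2.2.2 ∂μ) :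
    IsProbabilityMeasure μu ∧
    (μ Set.univ).toReal = ∫ p : ℝ × (Fin n → ℝ) × ℝ, p.1 ∂μu ∧
    (μ Set.univ).toReal ≤ T := by
  have hone : μu.real univ = 1 := by
    simpa [lieDeriv_const] using hLiou_one
  have hmass : μ.real univ = ∫ p : ℝ × (Fin n → ℝ) × ℝ, p.1 ∂μu := by
    simpa [lieDeriv_time] using hLiou_t.symm
  have hbound : ∀ᵐ p ∂μu, ‖p.1‖ ≤ T := by
    have hmem : ∀ᵐ p ∂μu, p ∈ Icc (0 : ℝ) T ×ˢ (Xu ×ˢ Icc (0 : ℝ) Jmax) :=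
      mem_ae_iff.mpr hμusupp
    filter_upwards [hmem] with p hp
    rw [Real.norm_of_nonneg hp.1.1]
    exact hp.1.2
  refine ⟨⟨?_⟩, hmass, ?_⟩
  · rwa [measureReal_def, ENNReal.toReal_eq_one_iff] at hone
  · have hle := norm_integral_le_of_norm_le_const hbound
    rw [hone, mul_one] at hle
    exact hmass.le.trans ((Real.le_norm_self _).trans hle)
end

section
/- Subvalue property: let v : ℝ × ℝⁿ × ℝ → ℝ be continuously differentiable and satisfy v(t, x, z) ≤ z for all (t, x, z) ∈ [0, T] × X_u × [0, J_max] and L_f v(t, x, z, w) ≥ 0 for all t ∈ [0, T], x ∈ X, (w, z) ∈ Ω. Then for every x' ∈ X and every z ∈ [0, J_max] such that there exists an admissible crashing trajectory with budget z starting at x' (i.e., with x(0) = x'), one has v(0, x', z) ≤ z. In other words, v(0, ·, ·) lower-bounds the fixed-z value function V(x', z) of the crash-safety optimal control problem wherever V is finite. -/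
open Set MeasureTheory

/-- An admissible crashing trajectory with budget `z` starting at `x'`. -/
def IsCrashingTrajFrom {n L : ℕ} (X Xu : Set (Fin n → ℝ)) (W : Set (Fin L → ℝ))
    (T : ℝ) (J : (Fin L → ℝ) → ℝ)
    (f : ℝ → (Fin n → ℝ) → (Fin L → ℝ) → (Fin n → ℝ))
    (x' : Fin n → ℝ) (z : ℝ) (tStar : ℝ) (x : ℝ → Fin n → ℝ) (w : ℝ → Fin L → ℝ) : Prop :=
  tStar ∈ Icc (0 : ℝ) T ∧ Measurable w ∧
  (∀ t' ∈ Icc (0 : ℝ) tStar, w t' ∈ W ∧ J (w t') ≤ z) ∧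
  (∀ t' ∈ Icc (0 : ℝ) tStar, x t' ∈ X) ∧ x 0 = x' ∧
  (∀ t' ∈ Icc (0 : ℝ) tStar, HasDerivAt x (f t' (x t') (w t')) t') ∧
  x tStar ∈ Xu

/-- Subvalue property: if `v ≤ z` on `[0, T] × X_u × [0, J_max]` and `L_f v ≥ 0` on
`[0, T] × X × Ω`, then `v(0, x', z) ≤ z` whenever there is an admissible crashing
trajectory with budget `z` starting at `x' ∈ X`; i.e., `v(0, ·, ·)` lower-bounds the
fixed-`z` value function wherever it is finite. -/
theorem subvalue_property {n L : ℕ} (X Xu : Set (Fin n → ℝ)) (W : Set (Fin L → ℝ))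
    (T Jmax : ℝ) (hT : 0 < T) (hJmax : 0 < Jmax) (hXu : Xu ⊆ X)
    (J : (Fin L → ℝ) → ℝ)
    (f : ℝ → (Fin n → ℝ) → (Fin L → ℝ) → (Fin n → ℝ))
    (v : ℝ × (Fin n → ℝ) × ℝ → ℝ) (hv : ContDiff ℝ 1 v)
    (hu : ∀ t ∈ Icc (0 : ℝ) T, ∀ x ∈ Xu, ∀ z ∈ Icc (0 : ℝ) Jmax, v (t, x, z) ≤ z)
    (hlie : ∀ t ∈ Icc (0 : ℝ) T, ∀ x ∈ X, ∀ w ∈ W, ∀ z ∈ Icc (0 : ℝ) Jmax,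
      J w ≤ z → 0 ≤ lieDeriv f v t x z w) :
    ∀ x' ∈ X, ∀ z ∈ Icc (0 : ℝ) Jmax,
      (∃ tStar x w, IsCrashingTrajFrom X Xu W T J f x' z tStar x w) →
      v (0, x', z) ≤ z := by
  rintro x' - z hz ⟨tStar, x, w, ht, -, hw, hx, rfl, hderiv, hend⟩
  have hmem : ∀ t ∈ Icc (0 : ℝ) tStar, t ∈ Icc (0 : ℝ) T := fun t h => ⟨h.1, h.2.trans ht.2⟩
  have hd : ∀ t ∈ Icc (0 : ℝ) tStar,
      HasDerivAt (fun s => v (s, x s, z)) (lieDeriv f v t (x t) z (w t)) t := fun t h =>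
    ((hv.differentiable one_ne_zero) (t, x t, z)).hasFDerivAt.comp_hasDerivAt t
      ((hasDerivAt_id t).prodMk ((hderiv t h).prodMk (hasDerivAt_const t z)))
  have hmono : MonotoneOn (fun s => v (s, x s, z)) (Icc 0 tStar) :=
    monotoneOn_of_hasDerivWithinAt_nonneg (convex_Icc 0 tStar)
      (fun t h => (hd t h).continuousAt.continuousWithinAt)
      (fun t h => (hd t (interior_subset h)).hasDerivWithinAt)
      (fun t h => have h' := interior_subset h
        hlie t (hmem t h') (x t) (hx t h') (w t) (hw t h').1 z hz (hw t h').2)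
  exact (hmono (left_mem_Icc.2 ht.1) (right_mem_Icc.2 ht.1) ht.1).trans
    (hu tStar ht (x tStar) hend z hz)
end

section
/- Subvalue map lower-bounds the crash cost: let v : ℝ × ℝⁿ × ℝ → ℝ be continuously differentiable with v(t, x, z) ≤ z for all (t, x, z) ∈ [0, T] × X_u × [0, J_max] and L_f v(t, x, z, w) ≥ 0 for all t ∈ [0, T], x ∈ X, (w, z) ∈ Ω, and let q : ℝⁿ → ℝ satisfy q(x) ≤ v(0, x, z) for all (x, z) ∈ X × [0, J_max]. Then for every x' ∈ X and every z ∈ [0, J_max] for which there exists an admissible crashing trajectory with budget z starting at x', one has q(x') ≤ z; consequently q(x') is a lower bound on Q(x'), the infimum of budgets z ∈ [0, J_max] admitting a crashing trajectory from x'. -/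
open Set MeasureTheory

/-- A `C¹` function with nonnegative Lie derivative along a crashing trajectory does not
decrease between its endpoints. -/
theorem IsCrashingTrajFrom.initial_le_terminal {n L : ℕ} {X Xu : Set (Fin n → ℝ)}
    {W : Set (Fin L → ℝ)} {T : ℝ} {J : (Fin L → ℝ) → ℝ}
    {f : ℝ → (Fin n → ℝ) → (Fin L → ℝ) → (Fin n → ℝ)} {x' : Fin n → ℝ} {z tStar : ℝ}
    {x : ℝ → Fin n → ℝ} {w : ℝ → Fin L → ℝ}
    (h : IsCrashingTrajFrom X Xu W T J f x' z tStar x w)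
    {v : ℝ × (Fin n → ℝ) × ℝ → ℝ} (hv : ContDiff ℝ 1 v)
    (hlie : ∀ t ∈ Icc (0 : ℝ) T, ∀ y ∈ X, ∀ u ∈ W, J u ≤ z → 0 ≤ lieDeriv f v t y z u) :
    v (0, x', z) ≤ v (tStar, x tStar, z) := by
  obtain ⟨ht, -, hw, hx, rfl, hd, -⟩ := h
  have hderiv : ∀ t ∈ Icc (0 : ℝ) tStar,
      HasDerivAt (fun s => v (s, x s, z)) (lieDeriv f v t (x t) z (w t)) t := fun t htt =>
    ((hv.differentiable one_ne_zero) (t, x t, z)).hasFDerivAt.comp_hasDerivAt t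
      ((hasDerivAt_id t).prodMk ((hd t htt).prodMk (hasDerivAt_const t z)))
  have hmono : MonotoneOn (fun s => v (s, x s, z)) (Icc 0 tStar) := by
    refine monotoneOn_of_hasDerivWithinAt_nonneg (convex_Icc 0 tStar)
      (fun t htt => (hderiv t htt).continuousAt.continuousWithinAt)
      (fun t htt => (hderiv t (interior_subset htt)).hasDerivWithinAt) fun t htt => ?_
    have htt := interior_subset htt
    exact hlie t ⟨htt.1, htt.2.trans ht.2⟩ _ (hx t htt) _ (hw t htt).1 (hw t htt).2
  exact hmono (left_mem_Icc.2 ht.1) (right_mem_Icc.2 ht.1) ht.1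

/-- Subvalue map lower-bounds the crash cost: if `v` satisfies the terminal and Lie
constraints and `q(x) ≤ v(0, x, z)` on `X × [0, J_max]`, then `q(x') ≤ z` for every
budget `z ∈ [0, J_max]` admitting a crashing trajectory from `x'`; consequently `q(x')`
is a lower bound on the set of such budgets (hence on `Q(x')`, their infimum). -/
theorem subvalue_map_lower_bound {n L : ℕ} (X Xu : Set (Fin n → ℝ)) (W : Set (Fin L → ℝ))
    (T Jmax : ℝ) (hT : 0 < T) (hJmax : 0 < Jmax) (hXu : Xu ⊆ X)
    (J : (Fin L → ℝ) → ℝ)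
    (f : ℝ → (Fin n → ℝ) → (Fin L → ℝ) → (Fin n → ℝ))
    (v : ℝ × (Fin n → ℝ) × ℝ → ℝ) (hv : ContDiff ℝ 1 v)
    (q : (Fin n → ℝ) → ℝ)
    (hu : ∀ t ∈ Icc (0 : ℝ) T, ∀ x ∈ Xu, ∀ z ∈ Icc (0 : ℝ) Jmax, v (t, x, z) ≤ z)
    (hlie : ∀ t ∈ Icc (0 : ℝ) T, ∀ x ∈ X, ∀ w ∈ W, ∀ z ∈ Icc (0 : ℝ) Jmax,
      J w ≤ z → 0 ≤ lieDeriv f v t x z w)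
    (hq : ∀ x ∈ X, ∀ z ∈ Icc (0 : ℝ) Jmax, q x ≤ v (0, x, z)) :
    ∀ x' ∈ X,
      (∀ z ∈ Icc (0 : ℝ) Jmax,
        (∃ tStar x w, IsCrashingTrajFrom X Xu W T J f x' z tStar x w) → q x' ≤ z) ∧
      q x' ∈ lowerBounds { z : ℝ | z ∈ Icc (0 : ℝ) Jmax ∧
        ∃ tStar x w, IsCrashingTrajFrom X Xu W T J f x' z tStar x w } := by
  intro x' hx'
  have key : ∀ z ∈ Icc (0 : ℝ) Jmax,
      (∃ tStar x w, IsCrashingTrajFrom X Xu W T J f x' z tStar x w) → q x' ≤ z := by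
    rintro z hz ⟨tStar, x, w, h⟩
    calc q x' ≤ v (0, x', z) := hq x' hx' z hz
      _ ≤ v (tStar, x tStar, z) :=
        h.initial_le_terminal hv fun t ht y hy u hu => hlie t ht y hy u hu z hz
      _ ≤ z := hu tStar h.1 _ h.2.2.2.2.2.2 z hz
  exact ⟨key, fun z hz => key z hz.1 hz.2⟩
end

section
/- Infeasibility certificate from a subvalue function: let v : ℝ × ℝⁿ × ℝ → ℝ be continuously differentiable with v(t, x, z) ≤ z for all (t, x, z) ∈ [0, T] × X_u × [0, J_max] and L_f v(t, x, z, w) ≥ 0 for all t ∈ [0, T], x ∈ X, (w, z) ∈ Ω. If x' ∈ X satisfies v(0, x', z) > J_max for every z ∈ [0, J_max], then for no z ∈ [0, J_max] does there exist an admissible crashing trajectory with budget z starting at x' (i.e., the crash cost Q(x') is infinite). -/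
open Set MeasureTheory

/-- Along a differentiable trajectory, `t ↦ v (t, x t, z)` has the Lie derivative of `v` as its
derivative. -/
theorem hasDerivAt_lieDeriv {n L : ℕ}
    {f : ℝ → (Fin n → ℝ) → (Fin L → ℝ) → (Fin n → ℝ)}
    {v : ℝ × (Fin n → ℝ) × ℝ → ℝ} (hv : Differentiable ℝ v)
    {x : ℝ → Fin n → ℝ} {w : Fin L → ℝ} {t : ℝ} (z : ℝ)
    (hx : HasDerivAt x (f t (x t) w) t) :
    HasDerivAt (fun s => v (s, x s, z)) (lieDeriv f v t (x t) z w) t :=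
  (hv (t, x t, z)).hasFDerivAt.comp_hasDerivAt t
    ((hasDerivAt_id t).prodMk (hx.prodMk (hasDerivAt_const t z)))

/-- Infeasibility certificate from a subvalue function: if `v` satisfies the terminal and
Lie constraints and `v(0, x', z) > J_max` for every `z ∈ [0, J_max]`, then no budget
`z ∈ [0, J_max]` admits an admissible crashing trajectory starting at `x'` (the crash
cost `Q(x')` is infinite). -/
theorem subvalue_infeasibility {n L : ℕ} (X Xu : Set (Fin n → ℝ)) (W : Set (Fin L → ℝ))
    (T Jmax : ℝ) (hT : 0 < T) (hJmax : 0 < Jmax) (hXu : Xu ⊆ X)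
    (J : (Fin L → ℝ) → ℝ)
    (f : ℝ → (Fin n → ℝ) → (Fin L → ℝ) → (Fin n → ℝ))
    (v : ℝ × (Fin n → ℝ) × ℝ → ℝ) (hv : ContDiff ℝ 1 v)
    (hu : ∀ t ∈ Icc (0 : ℝ) T, ∀ x ∈ Xu, ∀ z ∈ Icc (0 : ℝ) Jmax, v (t, x, z) ≤ z)
    (hlie : ∀ t ∈ Icc (0 : ℝ) T, ∀ x ∈ X, ∀ w ∈ W, ∀ z ∈ Icc (0 : ℝ) Jmax,
      J w ≤ z → 0 ≤ lieDeriv f v t x z w)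
    (x' : Fin n → ℝ) (hx' : x' ∈ X)
    (hbig : ∀ z ∈ Icc (0 : ℝ) Jmax, Jmax < v (0, x', z)) :
    ¬ ∃ z ∈ Icc (0 : ℝ) Jmax,
        ∃ tStar x w, IsCrashingTrajFrom X Xu W T J f x' z tStar x w := by
  rintro ⟨z, hz, tStar, x, w, ⟨h0, hT'⟩, -, hw, hxX, hx0, hderiv, hxu⟩
  have hd : ∀ t ∈ Icc (0 : ℝ) tStar,
      HasDerivAt (fun s => v (s, x s, z)) (lieDeriv f v t (x t) z (w t)) t := fun t ht =>
    hasDerivAt_lieDeriv (hv.differentiable one_ne_zero) z (hderiv t ht)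
  have hmono : MonotoneOn (fun s => v (s, x s, z)) (Icc 0 tStar) := by
    refine monotoneOn_of_hasDerivWithinAt_nonneg (convex_Icc 0 tStar)
      (fun t ht => (hd t ht).continuousAt.continuousWithinAt)
      (fun t ht => (hd t (interior_subset ht)).hasDerivWithinAt) fun t ht => ?_
    have ht := interior_subset ht
    exact hlie t ⟨ht.1, ht.2.trans hT'⟩ (x t) (hxX t ht) (w t) (hw t ht).1 z hz (hw t ht).2
  have hle : v (0, x 0, z) ≤ v (tStar, x tStar, z) :=
    hmono (left_mem_Icc.2 h0) (right_mem_Icc.2 h0) h0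
  rw [hx0] at hle
  linarith [hbig z hz, hu tStar ⟨h0, hT'⟩ (x tStar) hxu z hz, hz.2]
end

section
/- Weak duality between the measure program and the trajectory problem: assume f is continuous and W is compact. Let M be the set of real numbers of the form ∫ z̃ dμ_u over all triples (μ₀, μ_u, μ) of finite Borel measures on ℝⁿ × ℝ, ℝ × ℝⁿ × ℝ, and ℝ × ℝⁿ × ℝ × ℝ^L respectively, such that μ₀ is a probability measure vanishing outside X₀ × [0, J_max], μ_u vanishes outside [0, T] × X_u × [0, J_max], μ vanishes outside { (t, x, z, w) : t ∈ [0, T], x ∈ X, (w, z) ∈ Ω }, and the Liouville equation ∫ v dμ_u = ∫ v(0, x̃, z̃) dμ₀ + ∫ L_f v dμ holds for every continuously differentiable v : ℝ × ℝⁿ × ℝ → ℝ. Then for every z ∈ [0, J_max] admitting an admissible crashing trajectory (with continuous state) with budget z, one has sInf M ≤ z; hence sInf M ≤ Q*, the infimum of such budgets. -/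
open Set MeasureTheory

/-- The set `M` of attained objective values `∫ z̃ dμ_u` over feasible triples
`(μ₀, μ_u, μ)` of the measure linear program. -/
def measLPValues {n L : ℕ} (X X₀ Xu : Set (Fin n → ℝ)) (W : Set (Fin L → ℝ))
    (T Jmax : ℝ) (J : (Fin L → ℝ) → ℝ)
    (f : ℝ → (Fin n → ℝ) → (Fin L → ℝ) → (Fin n → ℝ)) : Set ℝ :=
  { r : ℝ | ∃ (μ₀ : Measure ((Fin n → ℝ) × ℝ)) (μu : Measure (ℝ × (Fin n → ℝ) × ℝ))
      (μ : Measure (ℝ × (Fin n → ℝ) × ℝ × (Fin L → ℝ))),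
      IsProbabilityMeasure μ₀ ∧ IsFiniteMeasure μu ∧ IsFiniteMeasure μ ∧
      μ₀ (X₀ ×ˢ Icc (0 : ℝ) Jmax)ᶜ = 0 ∧
      μu (Icc (0 : ℝ) T ×ˢ (Xu ×ˢ Icc (0 : ℝ) Jmax))ᶜ = 0 ∧
      μ { p : ℝ × (Fin n → ℝ) × ℝ × (Fin L → ℝ) |
          p.1 ∈ Icc (0 : ℝ) T ∧ p.2.1 ∈ X ∧ p.2.2.2 ∈ W ∧
          p.2.2.1 ∈ Icc (0 : ℝ) Jmax ∧ J p.2.2.2 ≤ p.2.2.1 }ᶜ = 0 ∧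
      (∀ v : ℝ × (Fin n → ℝ) × ℝ → ℝ, ContDiff ℝ 1 v →
        ∫ p, v p ∂μu =
          (∫ p : (Fin n → ℝ) × ℝ, v (0, p.1, p.2) ∂μ₀) +
          ∫ p : ℝ × (Fin n → ℝ) × ℝ × (Fin L → ℝ),
            lieDeriv f v p.1 p.2.1 p.2.2.1 p.2.2.2 ∂μ) ∧
      r = ∫ p : ℝ × (Fin n → ℝ) × ℝ, p.2.2 ∂μu }

theorem measLPValues_nonneg {n L : ℕ} {X X₀ Xu : Set (Fin n → ℝ)} {W : Set (Fin L → ℝ)}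
    {T Jmax : ℝ} {J : (Fin L → ℝ) → ℝ} {f : ℝ → (Fin n → ℝ) → (Fin L → ℝ) → (Fin n → ℝ)}
    {r : ℝ} (hr : r ∈ measLPValues X X₀ Xu W T Jmax J f) : 0 ≤ r := by
  obtain ⟨μ₀, μu, μ, -, -, -, -, hu, -, -, rfl⟩ := hr
  refine integral_nonneg_of_ae ?_
  filter_upwards [mem_ae_iff.2 hu] with p hp using hp.2.2.1

/-- The occupation measures of a crashing trajectory are feasible for the measure program. -/
theorem IsCrashingTraj.mem_measLPValues {n L : ℕ}
    {X X₀ Xu : Set (Fin n → ℝ)} {W : Set (Fin L → ℝ)} {T Jmax : ℝ}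
    {J : (Fin L → ℝ) → ℝ} {f : ℝ → (Fin n → ℝ) → (Fin L → ℝ) → (Fin n → ℝ)}
    (hf : Continuous fun p : ℝ × (Fin n → ℝ) × (Fin L → ℝ) => f p.1 p.2.1 p.2.2)
    (hW : IsCompact W) {z : ℝ} (hz : z ∈ Icc (0 : ℝ) Jmax) {tStar : ℝ} {x : ℝ → Fin n → ℝ}
    {w : ℝ → Fin L → ℝ} (hx : Continuous x)
    (h : IsCrashingTraj X X₀ Xu W T J f z tStar x w) :
    z ∈ measLPValues X X₀ Xu W T Jmax J f := by
  obtain ⟨ht, hw, hwW, hxX, hx0, hderiv, hxu⟩ := h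
  set γ : ℝ → ℝ × (Fin n → ℝ) × ℝ × (Fin L → ℝ) := fun t => (t, x t, z, w t) with hγ
  have hγm : Measurable γ :=
    measurable_id.prodMk (hx.measurable.prodMk (measurable_const.prodMk hw))
  refine ⟨Measure.dirac (x 0, z), Measure.dirac (tStar, x tStar, z),
    (volume.restrict (Icc 0 tStar)).map γ, inferInstance, inferInstance, inferInstance,
    ?_, ?_, ?_, ?_, ?_⟩
  · rw [← mem_ae_iff, ae_dirac_eq]
    exact ⟨hx0, hz⟩
  · rw [← mem_ae_iff, ae_dirac_eq]
    exact ⟨ht, hxu, hz⟩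
  · have hG : MeasurableSet {p : ℝ × (Fin n → ℝ) × ℝ × (Fin L → ℝ) |
        p.1 ∈ Icc 0 tStar ∧ p = γ p.1} :=
      (measurable_fst measurableSet_Icc).inter
        (measurableSet_eq_fun measurable_id (hγm.comp measurable_fst))
    refine measure_mono_null (compl_subset_compl.2 ?_)
      (?_ : (volume.restrict (Icc 0 tStar)).map γ
        {p : ℝ × (Fin n → ℝ) × ℝ × (Fin L → ℝ) | p.1 ∈ Icc 0 tStar ∧ p = γ p.1}ᶜ = 0)
    · rintro p ⟨hp, hpγ⟩
      rw [hpγ]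
      exact ⟨⟨hp.1, hp.2.trans ht.2⟩, hxX _ hp, (hwW _ hp).1, hz, (hwW _ hp).2⟩
    · rw [Measure.map_apply hγm hG.compl, preimage_compl, ← mem_ae_iff]
      filter_upwards [ae_restrict_mem measurableSet_Icc] with t ht' using ⟨ht', rfl⟩
  · intro v hv
    have hcont := continuous_lieDeriv hf hv
    rw [integral_dirac, integral_dirac, integral_map hγm.aemeasurable
      hcont.aestronglyMeasurable]
    have hint : IntegrableOn (fun t => lieDeriv f v t (x t) z (w t)) (Icc 0 tStar) := by
      obtain ⟨C, hC⟩ := (isCompact_Icc.prod ((isCompact_Icc.image hx).prod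
        ((isCompact_singleton (x := z)).prod hW))).exists_bound_of_continuousOn
          (s := Icc 0 tStar ×ˢ (x '' Icc 0 tStar) ×ˢ {z} ×ˢ W) hcont.continuousOn
      refine IntegrableOn.of_bound measure_Icc_lt_top
        (hcont.measurable.comp hγm).aestronglyMeasurable C ?_
      filter_upwards [ae_restrict_mem measurableSet_Icc] with t ht'
      exact hC (γ t) ⟨ht', mem_image_of_mem x ht', rfl, (hwW t ht').1⟩
    have hFTC := intervalIntegral.integral_eq_sub_of_hasDerivAt
      (f := fun t => v (t, x t, z)) (f' := fun t => lieDeriv f v t (x t) z (w t))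
      (a := 0) (b := tStar) (fun t ht' => ?_)
      ((intervalIntegrable_iff_integrableOn_Icc_of_le ht.1).2 hint)
    · rw [intervalIntegral.integral_of_le ht.1, ← integral_Icc_eq_integral_Ioc] at hFTC
      simp only [hγ]
      rw [hFTC]
      ring
    · rw [uIcc_of_le ht.1] at ht'
      exact (hv.differentiable one_ne_zero _).hasFDerivAt.comp_hasDerivAt t
        ((hasDerivAt_id t).prodMk ((hderiv t ht').prodMk (hasDerivAt_const t z)))
  · rw [integral_dirac]

/-- Weak duality between the measure program and the trajectory problem: assuming `f`
continuous and `W` compact, every budget `z ∈ [0, J_max]` admitting an admissible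
crashing trajectory with continuous state satisfies `sInf M ≤ z`; hence `sInf M ≤ Q*`,
the infimum of such budgets (whenever some budget is feasible). -/
theorem measure_weak_duality {n L : ℕ}
    (X X₀ Xu : Set (Fin n → ℝ)) (W : Set (Fin L → ℝ))
    (T Jmax : ℝ) (hT : 0 < T) (hJmax : 0 < Jmax)
    (hX₀ : X₀ ⊆ X) (hXu : Xu ⊆ X)
    (J : (Fin L → ℝ) → ℝ)
    (f : ℝ → (Fin n → ℝ) → (Fin L → ℝ) → (Fin n → ℝ))
    (hf : Continuous fun p : ℝ × (Fin n → ℝ) × (Fin L → ℝ) => f p.1 p.2.1 p.2.2)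
    (hW : IsCompact W) :
    (∀ z ∈ Icc (0 : ℝ) Jmax,
      (∃ tStar x w, Continuous x ∧ IsCrashingTraj X X₀ Xu W T J f z tStar x w) →
      sInf (measLPValues X X₀ Xu W T Jmax J f) ≤ z) ∧
    ((∃ z ∈ Icc (0 : ℝ) Jmax,
        ∃ tStar x w, Continuous x ∧ IsCrashingTraj X X₀ Xu W T J f z tStar x w) →
      sInf (measLPValues X X₀ Xu W T Jmax J f) ≤
        sInf { z : ℝ | z ∈ Icc (0 : ℝ) Jmax ∧
          ∃ tStar x w, Continuous x ∧ IsCrashingTraj X X₀ Xu W T J f z tStar x w }) := by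
  have hle : ∀ z ∈ Icc (0 : ℝ) Jmax,
      (∃ tStar x w, Continuous x ∧ IsCrashingTraj X X₀ Xu W T J f z tStar x w) →
      sInf (measLPValues X X₀ Xu W T Jmax J f) ≤ z := by
    rintro z hz ⟨tStar, x, w, hx, h⟩
    exact csInf_le ⟨0, fun _ => measLPValues_nonneg⟩ (h.mem_measLPValues hf hW hz hx)
  exact ⟨hle, fun h => le_csInf h fun z hz => hle z hz.1 hz.2⟩
end
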